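/- The inverse map v̂ := ŵ⁻¹ : ℝ^d → B_c(0) is differentiable everywhere, and for every v ∈ B_c(0) the divergence of v̂ at w = ŵ(v), i.e. the trace of D v̂(ŵ(v)), equals (d − 1)/λ₁(‖v‖) + 1/λ₂(‖v‖), which is strictly less than d. -/

import Mathlib

open Real

/-- The Lorentz factor `Γ(v) = c / √(c² − ‖v‖²)`. -/
noncomputable def Gam (c : ℝ) {d : ℕ} (v : EuclideanSpace ℝ (Fin d)) : ℝ :=
  c / Real.sqrt (c ^ 2 - ‖v‖ ^ 2)

/-- The relativistic-velocity map `ŵ(v) = Γ(v)(1 + Γ(v)/c²)·v`. -/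
noncomputable def what (c : ℝ) {d : ℕ} (v : EuclideanSpace ℝ (Fin d)) :
    EuclideanSpace ℝ (Fin d) :=
  (Gam c v * (1 + Gam c v / c ^ 2)) • v

/-- `λ₁(r) = c/√(c² − r²) + 1/(c² − r²)`. -/
noncomputable def lam1 (c r : ℝ) : ℝ :=
  c / Real.sqrt (c ^ 2 - r ^ 2) + 1 / (c ^ 2 - r ^ 2)

/-- `λ₂(r) = c·r²/(c² − r²)^{3/2} + 2r²/(c² − r²)² + c/√(c² − r²) + 1/(c² − r²)`. -/
noncomputable def lam2 (c r : ℝ) : ℝ :=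
  c * r ^ 2 / (c ^ 2 - r ^ 2) ^ ((3 : ℝ) / 2) + 2 * r ^ 2 / (c ^ 2 - r ^ 2) ^ 2 +
    c / Real.sqrt (c ^ 2 - r ^ 2) + 1 / (c ^ 2 - r ^ 2)

lemma phi_strict (c s : ℝ) (hs : 0 < c ^ 2 - s) :
    HasStrictDerivAt (fun s : ℝ => c / Real.sqrt (c ^ 2 - s) + 1 / (c ^ 2 - s))
      ((c / Real.sqrt (c ^ 2 - s) ^ 3 + 2 / Real.sqrt (c ^ 2 - s) ^ 4) / 2) s := by
  have hq : 0 < Real.sqrt (c ^ 2 - s) := Real.sqrt_pos.mpr hs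
  have h1 : HasStrictDerivAt (fun s : ℝ => c ^ 2 - s) (-1) s := by
    simpa using (hasStrictDerivAt_id s).const_sub (c ^ 2)
  have h2 := h1.sqrt hs.ne'
  have h3 := ((hasStrictDerivAt_const s c).div h2 hq.ne').add
    ((hasStrictDerivAt_const s (1:ℝ)).div h1 hs.ne')
  refine h3.congr_deriv ?_
  have hsq : c ^ 2 - s = Real.sqrt (c ^ 2 - s) ^ 2 := (Real.sq_sqrt hs.le).symm
  generalize Real.sqrt (c ^ 2 - s) = q at *
  rw [hsq]
  field_simp
  ring

lemma what_eq (c : ℝ) (hc : 0 < c) {d : ℕ} (v : EuclideanSpace ℝ (Fin d)) (hv : ‖v‖ < c) :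
    what c v = lam1 c ‖v‖ • v := by
  have hs : 0 < c ^ 2 - ‖v‖ ^ 2 := by nlinarith [norm_nonneg v]
  have hq : 0 < Real.sqrt (c ^ 2 - ‖v‖ ^ 2) := Real.sqrt_pos.mpr hs
  have hsq : c ^ 2 - ‖v‖ ^ 2 = Real.sqrt (c ^ 2 - ‖v‖ ^ 2) ^ 2 := (Real.sq_sqrt hs.le).symm
  unfold what Gam lam1
  congr 1
  generalize Real.sqrt (c ^ 2 - ‖v‖ ^ 2) = q at *
  rw [hsq]
  field_simp

lemma lam2_eq (c r : ℝ) (hs : 0 < c ^ 2 - r ^ 2) :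
    lam2 c r = lam1 c r + (c / Real.sqrt (c ^ 2 - r ^ 2) ^ 3
      + 2 / Real.sqrt (c ^ 2 - r ^ 2) ^ 4) * r ^ 2 := by
  have h : (c ^ 2 - r ^ 2) ^ ((3 : ℝ) / 2) = Real.sqrt (c ^ 2 - r ^ 2) ^ 3 := by
    rw [Real.sqrt_eq_rpow, ← Real.rpow_natCast (_ ^ (1 / 2 : ℝ)) 3, ← Real.rpow_mul hs.le]
    norm_num
  have h4 : Real.sqrt (c ^ 2 - r ^ 2) ^ 4 = (c ^ 2 - r ^ 2) ^ 2 := by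
    rw [show 4 = 2 * 2 from rfl, pow_mul, Real.sq_sqrt hs.le]
  unfold lam2 lam1
  rw [h, h4]
  ring

lemma one_lt_lam1 (c r : ℝ) (hc : 0 < c) (hs : 0 < c ^ 2 - r ^ 2) : 1 < lam1 c r := by
  have hq : 0 < Real.sqrt (c ^ 2 - r ^ 2) := Real.sqrt_pos.mpr hs
  have h1 : 1 ≤ c / Real.sqrt (c ^ 2 - r ^ 2) := by
    rw [le_div_iff₀ hq, one_mul]
    apply Real.sqrt_le_iff.mpr
    exact ⟨hc.le, by nlinarith [sq_nonneg r]⟩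
  have h2 : 0 < 1 / (c ^ 2 - r ^ 2) := by positivity
  unfold lam1
  linarith

lemma vhat_strict (d : ℕ) (c : ℝ) (hc : 0 < c)
    (vhat : EuclideanSpace ℝ (Fin d) → EuclideanSpace ℝ (Fin d))
    (hl : ∀ v : EuclideanSpace ℝ (Fin d), ‖v‖ < c → vhat (what c v) = v)
    (v : EuclideanSpace ℝ (Fin d)) (hv : ‖v‖ < c) :
    ∃ k : ℝ, lam2 c ‖v‖ = lam1 c ‖v‖ + k * ‖v‖ ^ 2 ∧ 0 ≤ k ∧
    HasFDerivAt vhat ((1 / lam1 c ‖v‖) • (ContinuousLinearMap.id ℝ _ -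
      (k / lam2 c ‖v‖) • (innerSL ℝ v).smulRight v)) (what c v) := by
  have hs : 0 < c ^ 2 - ‖v‖ ^ 2 := by nlinarith [norm_nonneg v]
  have h12 := lam2_eq c ‖v‖ hs
  have hg := one_lt_lam1 c ‖v‖ hc hs
  have hphi := phi_strict c (‖v‖ ^ 2) hs
  have hk : 0 ≤ (c / Real.sqrt (c ^ 2 - ‖v‖ ^ 2) ^ 3
      + 2 / Real.sqrt (c ^ 2 - ‖v‖ ^ 2) ^ 4) := by positivity
  generalize (c / Real.sqrt (c ^ 2 - ‖v‖ ^ 2) ^ 3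
      + 2 / Real.sqrt (c ^ 2 - ‖v‖ ^ 2) ^ 4) = k at *
  refine ⟨k, h12, hk, ?_⟩
  have hl2 : 0 < lam2 c ‖v‖ := by rw [h12]; positivity
  have hin : inner ℝ v v = ‖v‖ ^ 2 := real_inner_self_eq_norm_sq v
  have hcomp := (hphi.comp_hasStrictFDerivAt v (hasStrictFDerivAt_norm_sq v)).smul
    (hasStrictFDerivAt_id v)
  have hev : ∀ᶠ x in nhds v, ‖x‖ < c :=
    (continuous_norm.tendsto v).eventually (gt_mem_nhds hv)
  have hw : HasStrictFDerivAt (what c) (lam1 c ‖v‖ • ContinuousLinearMap.id ℝ _ +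
      k • (innerSL ℝ v).smulRight v) v := by
    refine (hcomp.congr_of_eventuallyEq ?_).congr_fderiv ?_
    · filter_upwards [hev] with x hx
      rw [what_eq c hc x hx]
      simp [lam1]
    · ext1 h
      simp [lam1, smul_smul]
      congr 1
      ring
  let A : EuclideanSpace ℝ (Fin d) ≃L[ℝ] EuclideanSpace ℝ (Fin d) :=
    ContinuousLinearEquiv.equivOfInverse (lam1 c ‖v‖ • ContinuousLinearMap.id ℝ _ +
      k • (innerSL ℝ v).smulRight v) ((1 / lam1 c ‖v‖) • (ContinuousLinearMap.id ℝ _ -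
      (k / lam2 c ‖v‖) • (innerSL ℝ v).smulRight v))
      (by
        intro h
        have hg0 : lam1 c ‖v‖ ≠ 0 := by positivity
        simp [inner_add_right, inner_smul_right, hin]
        match_scalars
        · field_simp
        · field_simp
          rw [h12]; ring)
      (by
        intro h
        have hg0 : lam1 c ‖v‖ ≠ 0 := by positivity
        simp [inner_sub_right, inner_smul_right, hin]
        match_scalars
        · field_simp
        · field_simp
          rw [h12]; ring)
  have hA : HasStrictFDerivAt (what c) (A : EuclideanSpace ℝ (Fin d) →L[ℝ] _) v := hw
  have := hA.to_local_left_inverse (g := vhat) (by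
    filter_upwards [hev] with x hx using hl x hx)
  exact this.hasFDerivAt

theorem stmt7 (d : ℕ) (hd : 1 ≤ d) (c : ℝ) (hc : 0 < c)
    (vhat : EuclideanSpace ℝ (Fin d) → EuclideanSpace ℝ (Fin d))
    (hvhat_ball : ∀ w, ‖vhat w‖ < c)
    (hvhat_left : ∀ v : EuclideanSpace ℝ (Fin d), ‖v‖ < c → vhat (what c v) = v)
    (hvhat_right : ∀ w, what c (vhat w) = w) :
    Differentiable ℝ vhat ∧
    ∀ v : EuclideanSpace ℝ (Fin d), ‖v‖ < c →
      LinearMap.trace ℝ (EuclideanSpace ℝ (Fin d))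
          (fderiv ℝ vhat (what c v)).toLinearMap
        = ((d : ℝ) - 1) / lam1 c ‖v‖ + 1 / lam2 c ‖v‖ ∧
      ((d : ℝ) - 1) / lam1 c ‖v‖ + 1 / lam2 c ‖v‖ < d := by
  constructor
  · intro w
    obtain ⟨k, -, -, h⟩ := vhat_strict d c hc vhat hvhat_left (vhat w) (hvhat_ball w)
    rw [hvhat_right] at h
    exact h.differentiableAt
  · intro v hv
    have hs : 0 < c ^ 2 - ‖v‖ ^ 2 := by nlinarith [norm_nonneg v]
    have hg := one_lt_lam1 c ‖v‖ hc hs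
    obtain ⟨k, h12, hk, h⟩ := vhat_strict d c hc vhat hvhat_left v hv
    have hl2 : 1 < lam2 c ‖v‖ := by
      rw [h12]
      have : 0 ≤ k * ‖v‖ ^ 2 := by positivity
      linarith
    constructor
    · have htr : LinearMap.trace ℝ (EuclideanSpace ℝ (Fin d))
          ((innerSL ℝ v).toLinearMap.smulRight v) = ‖v‖ ^ 2 := by
        rw [← real_inner_self_eq_norm_sq v]
        exact LinearMap.trace_smulRight _ _
      rw [h.fderiv]
      have e : ((1 / lam1 c ‖v‖) • (ContinuousLinearMap.id ℝ (EuclideanSpace ℝ (Fin d)) -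
        (k / lam2 c ‖v‖) • (innerSL ℝ v).smulRight v)).toLinearMap
        = (1 / lam1 c ‖v‖) • (LinearMap.id - (k / lam2 c ‖v‖) •
          ((innerSL ℝ v).toLinearMap.smulRight v)) := rfl
      rw [e, map_smul, map_sub, map_smul, htr, LinearMap.trace_id]
      have h1 : lam1 c ‖v‖ ≠ 0 := by positivity
      have h2 : lam2 c ‖v‖ ≠ 0 := by positivity
      simp only [finrank_euclideanSpace, Fintype.card_fin, smul_eq_mul]
      field_simp
      rw [h12]; ring
    · have h1 : ((d : ℝ) - 1) / lam1 c ‖v‖ ≤ (d : ℝ) - 1 := by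
        apply div_le_self _ hg.le
        have : (1 : ℝ) ≤ d := by exact_mod_cast hd
        linarith
      have h2 : 1 / lam2 c ‖v‖ < 1 := by
        rw [div_lt_one (by positivity)]; exact hl2
      linarith
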